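/- Let X₁,…,X_K (K ≥ 3) be measurable spaces, X = X₁ × ⋯ × X_K, and π a probability measure on X. Let I be a nonempty proper subset of {1,…,K} such that E_{Iᶜ} is a proper subspace of L²(π), let g ≥ 2, and let J₁,…,J_g be nonempty proper subsets of I with ⋃_{d=1}^g J_d = I. Then σ(P_{E_{J₁∪Iᶜ}}P_{E_{J₂∪Iᶜ}}⋯P_{E_{J_g∪Iᶜ}} − Π) = σ(P_{E_{J₁}^{(I)}}P_{E_{J₂}^{(I)}}⋯P_{E_{J_g}^{(I)}} − Π_I), and for every (v₁,…,v_g) ∈ 𝒮_g, σ(∑_{d=1}^g v_d P_{E_{J_d∪Iᶜ}} − Π) = σ(∑_{d=1}^g v_d P_{E_{J_d}^{(I)}} − Π_I). -/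

import Mathlib

open MeasureTheory
open scoped ENNReal

set_option linter.unusedSectionVars false

/-- The orthogonal projection onto a closed subspace, as an operator on the ambient space. -/
noncomputable def proj {H : Type*} [NormedAddCommGroup H] [InnerProductSpace ℂ H]
    [CompleteSpace H] (S : Submodule ℂ H) (hS : IsClosed (S : Set H)) : H →L[ℂ] H :=
  haveI : CompleteSpace S := hS.completeSpace_coe
  S.subtypeL.comp (S.orthogonalProjection)

variable {α : Type*} [MeasurableSpace α]

/-- The closed subspace of `L²(μ)` of elements having a representative measurable with respect
to the σ-algebra generated by the map `g` (the functions "depending only on `g`"). -/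
noncomputable def depOn {β : Type*} [mβ : MeasurableSpace β] (μ : Measure α) (g : α → β) :
    Submodule ℂ (Lp ℂ 2 μ) :=
  lpMeas ℂ ℂ (mβ.comap g) 2 μ

lemma isClosed_depOn {β : Type*} [mβ : MeasurableSpace β] (μ : Measure α) {g : α → β}
    (hg : Measurable g) : IsClosed ((depOn μ g : Set (Lp ℂ 2 μ))) := by
  haveI : Fact ((1 : ℝ≥0∞) ≤ 2) := ⟨one_le_two⟩
  exact isClosed_aestronglyMeasurable hg.comap_le

/-- The subspace of (a.e.) constant functions in `L²(μ)`: the span of the constant function 1. -/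
noncomputable def constSub (μ : Measure α) [IsFiniteMeasure μ] : Submodule ℂ (Lp ℂ 2 μ) :=
  Submodule.span ℂ {MemLp.toLp (fun _ => (1 : ℂ)) (memLp_const (1 : ℂ))}

lemma isClosed_constSub (μ : Measure α) [IsFiniteMeasure μ] :
    IsClosed ((constSub μ : Set (Lp ℂ 2 μ))) := by
  haveI : FiniteDimensional ℂ (constSub μ) :=
    FiniteDimensional.span_singleton (K := ℂ) (MemLp.toLp (fun _ => (1 : ℂ)) (memLp_const (1 : ℂ)))
  exact Submodule.closed_of_finiteDimensional _

section Product

variable {K : ℕ} {X : Fin K → Type*} [∀ i, MeasurableSpace (X i)]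

/-- Restriction of a point of the product space to the coordinates lying outside `S`. -/
def restOut (S : Finset (Fin K)) (x : ∀ i, X i) : ∀ i : {i : Fin K // i ∉ S}, X i.val :=
  fun i => x i.val

lemma measurable_restOut (S : Finset (Fin K)) : Measurable (restOut (X := X) S) :=
  measurable_pi_lambda _ fun i => measurable_pi_apply i.val

/-- Restriction of a point of the product space to the coordinates lying in `I`
(the map `x ↦ x_I`). -/
def restIn (I : Finset (Fin K)) (x : ∀ i, X i) : ∀ i : {i : Fin K // i ∈ I}, X i.val :=
  fun i => x i.val

lemma measurable_restIn (I : Finset (Fin K)) : Measurable (restIn (X := X) I) :=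
  measurable_pi_lambda _ fun i => measurable_pi_apply i.val

/-- Restriction of a point of the marginal space `X_I` to the coordinates lying outside `S`. -/
def restOutIn (I S : Finset (Fin K)) (y : ∀ i : {i : Fin K // i ∈ I}, X i.val) :
    ∀ j : {i : {i : Fin K // i ∈ I} // i.val ∉ S}, X j.val.val :=
  fun j => y j.val

lemma measurable_restOutIn (I S : Finset (Fin K)) : Measurable (restOutIn (X := X) I S) :=
  measurable_pi_lambda _ fun j => measurable_pi_apply j.val

section Helpers

lemma spectrum_conj_aux {H₁ H₂ : Type*} [NormedAddCommGroup H₁] [NormedSpace ℂ H₁]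
    [NormedAddCommGroup H₂] [NormedSpace ℂ H₂]
    (U : H₁ →L[ℂ] H₂) (V : H₂ →L[ℂ] H₁) (hVU : ∀ x, V (U x) = x)
    (hU : ¬ Function.Surjective U)
    (T : H₁ →L[ℂ] H₁) (A : H₂ →L[ℂ] H₂) (hA : ∀ y, A y = U (T (V y)))
    (e : H₁) (he : e ≠ 0) (hTe : T e = 0) :
    spectrum ℂ A = spectrum ℂ T := by
  ext z
  rw [spectrum.mem_iff, spectrum.mem_iff, not_iff_not]
  rcases eq_or_ne z 0 with rfl | hz
  · simp only [map_zero, zero_sub, IsUnit.neg_iff]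
    constructor
    · rintro ⟨u, hu⟩
      exfalso
      apply hU
      intro y
      have h : A * (↑u⁻¹ : H₂ →L[ℂ] H₂) = 1 := by rw [← hu]; exact u.mul_inv
      have h2 := congrArg (fun B : H₂ →L[ℂ] H₂ => B y) h
      simp only [ContinuousLinearMap.mul_apply, ContinuousLinearMap.one_apply, hA] at h2
      exact ⟨_, h2⟩
    · rintro ⟨u, hu⟩
      exfalso
      apply he
      have h : (↑u⁻¹ : H₁ →L[ℂ] H₁) * T = 1 := by rw [← hu]; exact u.inv_mul
      have h2 := congrArg (fun B : H₁ →L[ℂ] H₁ => B e) h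
      simp only [ContinuousLinearMap.mul_apply, ContinuousLinearMap.one_apply, hTe, map_zero] at h2
      exact h2.symm
  · constructor
    · rintro ⟨u, hu⟩
      have h1 : ∀ y, z • (↑u⁻¹ : H₂ →L[ℂ] H₂) y - A ((↑u⁻¹ : H₂ →L[ℂ] H₂) y) = y := by
        intro y
        have := congrArg (fun B : H₂ →L[ℂ] H₂ => B y) u.mul_inv
        rw [hu] at this
        simpa [Algebra.algebraMap_eq_smul_one] using this
      have h2 : ∀ y, (↑u⁻¹ : H₂ →L[ℂ] H₂) (z • y - A y) = y := by
        intro y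
        have := congrArg (fun B : H₂ →L[ℂ] H₂ => B y) u.inv_mul
        rw [hu] at this
        simpa [Algebra.algebraMap_eq_smul_one] using this
      refine ⟨⟨_, V ∘L (↑u⁻¹ : H₂ →L[ℂ] H₂) ∘L U, ?_, ?_⟩, rfl⟩
      · ext x
        have := congrArg V (h1 (U x))
        simp only [map_sub, map_smul, hA, hVU] at this
        simpa [Algebra.algebraMap_eq_smul_one] using this
      · ext x
        have h3 := h2 (U x)
        rw [hA, hVU, ← map_smul, ← map_sub] at h3
        have := congrArg V h3
        rw [hVU] at this
        simpa [Algebra.algebraMap_eq_smul_one] using this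
    · rintro ⟨u, hu⟩
      have h1 : ∀ y, z • (↑u⁻¹ : H₁ →L[ℂ] H₁) y - T ((↑u⁻¹ : H₁ →L[ℂ] H₁) y) = y := by
        intro y
        have := congrArg (fun B : H₁ →L[ℂ] H₁ => B y) u.mul_inv
        rw [hu] at this
        simpa [Algebra.algebraMap_eq_smul_one] using this
      have h2 : ∀ y, (↑u⁻¹ : H₁ →L[ℂ] H₁) (z • y - T y) = y := by
        intro y
        have := congrArg (fun B : H₁ →L[ℂ] H₁ => B y) u.inv_mul
        rw [hu] at this
        simpa [Algebra.algebraMap_eq_smul_one] using this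
      refine ⟨⟨_, U ∘L (↑u⁻¹ : H₁ →L[ℂ] H₁) ∘L V + z⁻¹ • (1 - U ∘L V), ?_, ?_⟩, rfl⟩
      · ext y
        have h3 := congrArg U (h1 (V y))
        rw [map_sub, map_smul] at h3
        simp only [Algebra.algebraMap_eq_smul_one, ContinuousLinearMap.mul_apply,
          ContinuousLinearMap.sub_apply, ContinuousLinearMap.add_apply,
          ContinuousLinearMap.smul_apply, ContinuousLinearMap.one_apply,
          ContinuousLinearMap.comp_apply, hA, map_add, map_sub, map_smul, hVU]
        rw [h3, sub_sub_sub_cancel_right, ← smul_sub, smul_smul, inv_mul_cancel₀ hz, one_smul,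
          add_sub_cancel]
      · ext y
        have h3 := congrArg U (h2 (V y))
        simp only [Algebra.algebraMap_eq_smul_one, ContinuousLinearMap.mul_apply,
          ContinuousLinearMap.sub_apply, ContinuousLinearMap.add_apply,
          ContinuousLinearMap.smul_apply, ContinuousLinearMap.one_apply,
          ContinuousLinearMap.comp_apply, hA, map_sub, map_smul, hVU] at h3 ⊢
        rw [smul_add, add_sub_add_comm, h3, sub_self, smul_zero, sub_zero, smul_smul,
          mul_inv_cancel₀ hz, one_smul, add_sub_cancel]

lemma list_prod_conj_aux {H₁ H₂ : Type*} [NormedAddCommGroup H₁] [NormedSpace ℂ H₁]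
    [NormedAddCommGroup H₂] [NormedSpace ℂ H₂]
    (U : H₁ →L[ℂ] H₂) (V : H₂ →L[ℂ] H₁) (hVU : ∀ x, V (U x) = x) :
    ∀ (n : ℕ) (Q : Fin (n + 1) → H₁ →L[ℂ] H₁) (P : Fin (n + 1) → H₂ →L[ℂ] H₂),
      (∀ d y, P d y = U (Q d (V y))) → ∀ y,
      (List.ofFn P).prod y = U ((List.ofFn Q).prod (V y)) := by
  intro n
  induction n with
  | zero => intro Q P h y; simp [h]
  | succ n ih =>
    intro Q P h y
    rw [List.ofFn_succ, List.ofFn_succ (f := Q), List.prod_cons, List.prod_cons,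
      ContinuousLinearMap.mul_apply, ContinuousLinearMap.mul_apply, h,
      ih (fun i => Q i.succ) (fun i => P i.succ) (fun d => h d.succ), hVU]

lemma list_prod_fix_aux {H₁ : Type*} [NormedAddCommGroup H₁] [NormedSpace ℂ H₁] (e : H₁) :
    ∀ (n : ℕ) (Q : Fin n → H₁ →L[ℂ] H₁), (∀ d, Q d e = e) → (List.ofFn Q).prod e = e := by
  intro n
  induction n with
  | zero => intro Q h; simp
  | succ n ih =>
    intro Q h
    rw [List.ofFn_succ, List.prod_cons, ContinuousLinearMap.mul_apply,
      ih (fun i => Q i.succ) (fun d => h d.succ), h]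

lemma proj_eq_of_aux {H : Type*} [NormedAddCommGroup H] [InnerProductSpace ℂ H]
    [CompleteSpace H] (S : Submodule ℂ H) (hS : IsClosed (S : Set H)) {x y : H}
    (hy : y ∈ S) (h : ∀ w ∈ S, inner ℂ (x - y) w = 0) : proj S hS x = y := by
  haveI : CompleteSpace S := hS.completeSpace_coe
  exact Submodule.eq_starProjection_of_mem_of_inner_eq_zero hy h

lemma proj_mem_aux {H : Type*} [NormedAddCommGroup H] [InnerProductSpace ℂ H]
    [CompleteSpace H] (S : Submodule ℂ H) (hS : IsClosed (S : Set H)) (x : H) :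
    proj S hS x ∈ S := by
  haveI : CompleteSpace S := hS.completeSpace_coe
  exact Subtype.coe_prop _

lemma proj_inner_aux {H : Type*} [NormedAddCommGroup H] [InnerProductSpace ℂ H]
    [CompleteSpace H] (S : Submodule ℂ H) (hS : IsClosed (S : Set H)) (x w : H) (hw : w ∈ S) :
    inner ℂ (x - proj S hS x) w = 0 := by
  haveI : CompleteSpace S := hS.completeSpace_coe
  exact Submodule.starProjection_inner_eq_zero x w hw

lemma proj_fix_aux {H : Type*} [NormedAddCommGroup H] [InnerProductSpace ℂ H]
    [CompleteSpace H] (S : Submodule ℂ H) (hS : IsClosed (S : Set H)) (x : H) (hx : x ∈ S) :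
    proj S hS x = x :=
  proj_eq_of_aux S hS hx (by simp)

lemma proj_conj_aux {H₁ H₂ : Type*} [NormedAddCommGroup H₁] [InnerProductSpace ℂ H₁]
    [CompleteSpace H₁] [NormedAddCommGroup H₂] [InnerProductSpace ℂ H₂] [CompleteSpace H₂]
    (U : H₁ →ₗᵢ[ℂ] H₂) (S : Submodule ℂ H₂) (hS : IsClosed (S : Set H₂))
    (S₁ : Submodule ℂ H₁) (hS₁ : IsClosed (S₁ : Set H₁))
    (hm : ∀ y, y ∈ S ↔ ∃ x ∈ S₁, U x = y) (y : H₂) :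
    proj S hS y = U (proj S₁ hS₁ (ContinuousLinearMap.adjoint U.toContinuousLinearMap y)) := by
  apply proj_eq_of_aux
  · exact (hm _).2 ⟨_, proj_mem_aux _ _ _, rfl⟩
  · intro w hw
    obtain ⟨x, hx, rfl⟩ := (hm w).1 hw
    have h := proj_inner_aux S₁ hS₁ (ContinuousLinearMap.adjoint U.toContinuousLinearMap y) x hx
    rw [inner_sub_left, ContinuousLinearMap.adjoint_inner_left] at h
    rw [inner_sub_left, U.inner_map_map]
    exact h

lemma depOn_comp_aux {β γ δ : Type*} [mβ : MeasurableSpace β] [mγ : MeasurableSpace γ]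
    [mδ : MeasurableSpace δ] (μ : Measure β) (φ : β → γ) (hφ : Measurable φ) (ψ : γ → δ)
    (hψ : Measurable ψ) (y : Lp ℂ 2 μ) :
    y ∈ depOn μ (ψ ∘ φ) ↔ ∃ x ∈ depOn (μ.map φ) ψ,
      Lp.compMeasurePreservingₗᵢ ℂ φ (hφ.measurePreserving μ) x = y := by
  constructor
  · intro hy
    have hy' : AEStronglyMeasurable[mδ.comap (ψ ∘ φ)] (y : β → ℂ) μ := hy
    obtain ⟨f, hf, hyf⟩ := hy'
    obtain ⟨h, hh, rfl⟩ := hf.exists_eq_measurable_comp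
    have hm : MemLp (h ∘ ψ) 2 (μ.map φ) := by
      rw [memLp_map_measure_iff (hh.comp_measurable hψ).aestronglyMeasurable hφ.aemeasurable]
      exact (memLp_congr_ae hyf).1 (Lp.memLp y)
    refine ⟨hm.toLp _, ?_, ?_⟩
    · have : AEStronglyMeasurable[mδ.comap ψ] (hm.toLp _ : γ → ℂ) (μ.map φ) :=
        ⟨h ∘ ψ, hh.comp_measurable (comap_measurable ψ), hm.coeFn_toLp⟩
      exact this
    · apply Lp.ext
      refine Filter.EventuallyEq.trans ?_ hyf.symm
      refine (Lp.coeFn_compMeasurePreserving _ (hφ.measurePreserving μ)).trans ?_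
      exact ae_eq_comp hφ.aemeasurable hm.coeFn_toLp
  · rintro ⟨x, hx, rfl⟩
    have hx' : AEStronglyMeasurable[mδ.comap ψ] (x : γ → ℂ) (μ.map φ) := hx
    obtain ⟨f, hf, hxf⟩ := hx'
    have : AEStronglyMeasurable[mδ.comap (ψ ∘ φ)]
        (Lp.compMeasurePreservingₗᵢ ℂ φ (hφ.measurePreserving μ) x : β → ℂ) μ := by
      refine ⟨f ∘ φ, ?_, (Lp.coeFn_compMeasurePreserving x (hφ.measurePreserving μ)).trans
        (ae_eq_comp hφ.aemeasurable hxf)⟩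
      rw [← MeasurableSpace.comap_comp]
      exact hf.comp_measurable (comap_measurable φ)
    exact this

lemma depOn_congr_aux {β γ δ : Type*} [mβ : MeasurableSpace β] [mγ : MeasurableSpace γ]
    [mδ : MeasurableSpace δ] (μ : Measure β) (φ : β → γ) (ψ : β → δ)
    (a : γ → δ) (ha : Measurable a) (b : δ → γ) (hb : Measurable b)
    (h1 : ψ = a ∘ φ) (h2 : φ = b ∘ ψ) : depOn μ φ = depOn μ ψ := by
  have : mγ.comap φ = mδ.comap ψ := by
    apply le_antisymm
    · rw [h2, ← MeasurableSpace.comap_comp]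
      exact MeasurableSpace.comap_mono hb.comap_le
    · rw [h1, ← MeasurableSpace.comap_comp]
      exact MeasurableSpace.comap_mono ha.comap_le
  unfold depOn
  rw [this]

lemma depOn_restOut_aux {K : ℕ} {X : Fin K → Type*} [∀ i, MeasurableSpace (X i)]
    (π : Measure (∀ i, X i)) (I S : Finset (Fin K)) :
    depOn π (restOut (S ∪ Iᶜ)) = depOn π (restOutIn I S ∘ restIn (X := X) I) := by
  have key : ∀ i, i ∉ S ∪ Iᶜ ↔ i ∈ I ∧ i ∉ S := by intro i; simp; tauto
  refine depOn_congr_aux π _ _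
    (fun z j => z ⟨j.1.1, (key _).2 ⟨j.1.2, j.2⟩⟩)
    (measurable_pi_lambda _ fun j => measurable_pi_apply _)
    (fun z j => z ⟨⟨j.1, ((key _).1 j.2).1⟩, ((key _).1 j.2).2⟩)
    (measurable_pi_lambda _ fun j =>
      measurable_pi_apply (X := fun j : {i : {i : Fin K // i ∈ I} // i.val ∉ S} => X j.val.val) _)
    rfl rfl

lemma depOn_restIn_aux {K : ℕ} {X : Fin K → Type*} [∀ i, MeasurableSpace (X i)]
    (π : Measure (∀ i, X i)) (I : Finset (Fin K)) :
    depOn π (restOut Iᶜ) = depOn π (id ∘ restIn (X := X) I) := by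
  refine depOn_congr_aux π _ _
    (fun z j => z ⟨j.1, by simp⟩)
    (measurable_pi_lambda _ fun j => measurable_pi_apply _)
    (fun z j => z ⟨j.1, by simpa using j.2⟩)
    (measurable_pi_lambda _ fun j =>
      measurable_pi_apply (X := fun j : {i : Fin K // i ∈ I} => X j.val) _)
    rfl rfl

lemma constSub_aux {β γ : Type*} [mβ : MeasurableSpace β] [mγ : MeasurableSpace γ]
    (μ : Measure β) [IsFiniteMeasure μ] (φ : β → γ) (hφ : Measurable φ)
    [IsFiniteMeasure (μ.map φ)] (y : Lp ℂ 2 μ) :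
    y ∈ constSub μ ↔ ∃ x ∈ constSub (μ.map φ),
      Lp.compMeasurePreservingₗᵢ ℂ φ (hφ.measurePreserving μ) x = y := by
  have h1 : Lp.compMeasurePreservingₗᵢ ℂ φ (hφ.measurePreserving μ)
      (MemLp.toLp (p := 2) (fun _ => (1 : ℂ)) (memLp_const (1 : ℂ))) =
      MemLp.toLp (p := 2) (fun _ => (1 : ℂ)) (memLp_const (1 : ℂ)) := rfl
  unfold constSub
  simp only [Submodule.mem_span_singleton]
  constructor
  · rintro ⟨c, rfl⟩
    exact ⟨_, ⟨c, rfl⟩, by rw [map_smul, h1]⟩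
  · rintro ⟨_, ⟨c, rfl⟩, rfl⟩
    exact ⟨c, by rw [map_smul, h1]⟩

end Helpers

/-- The spectrum of a cycle (resp. mixture) of collapsed Gibbs steps on
`L²(π_I)`, shifted by the projection onto the constants, coincides with the spectrum of the
corresponding cycle (resp. mixture) of Gibbs steps on `L²(π)`. -/
theorem spectrum_collapsed_eq_spectrum_full
    (hK : 3 ≤ K) (π : Measure (∀ i, X i)) [IsProbabilityMeasure π]
    (I : Finset (Fin K)) (hIne : I.Nonempty) (hIproper : I ≠ Finset.univ)
    (hEIc : depOn π (restOut Iᶜ) ≠ ⊤)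
    {g : ℕ} (hg : 2 ≤ g) (J : Fin g → Finset (Fin K))
    (hJne : ∀ d, (J d).Nonempty) (hJproper : ∀ d, J d ⊂ I)
    (hJcover : ∀ i ∈ I, ∃ d, i ∈ J d) :
    haveI : IsProbabilityMeasure (π.map (restIn I)) :=
      Measure.isProbabilityMeasure_map (measurable_restIn I).aemeasurable
    (spectrum ℂ
        ((List.ofFn fun d =>
            proj (depOn π (restOut (J d ∪ Iᶜ))) (isClosed_depOn π (measurable_restOut _))).prod
          - proj (constSub π) (isClosed_constSub π)) =
      spectrum ℂ
        ((List.ofFn fun d =>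
            proj (depOn (π.map (restIn I)) (restOutIn I (J d)))
              (isClosed_depOn _ (measurable_restOutIn I (J d)))).prod
          - proj (constSub (π.map (restIn I))) (isClosed_constSub _))) ∧
    ∀ v : Fin g → ℝ, (∀ d, 0 < v d) → ∑ d, v d = 1 →
      spectrum ℂ
          ((∑ d, (v d : ℂ) •
              proj (depOn π (restOut (J d ∪ Iᶜ))) (isClosed_depOn π (measurable_restOut _)))
            - proj (constSub π) (isClosed_constSub π)) =
        spectrum ℂ
          ((∑ d, (v d : ℂ) •
              proj (depOn (π.map (restIn I)) (restOutIn I (J d)))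
                (isClosed_depOn _ (measurable_restOutIn I (J d))))
            - proj (constSub (π.map (restIn I))) (isClosed_constSub _)) := by
  haveI hprob : IsProbabilityMeasure (π.map (restIn I)) :=
    Measure.isProbabilityMeasure_map (measurable_restIn I).aemeasurable
  have hφ := measurable_restIn (X := X) I
  let U := Lp.compMeasurePreservingₗᵢ (E := ℂ) (p := 2) ℂ (restIn (X := X) I)
    (hφ.measurePreserving π)
  let V := ContinuousLinearMap.adjoint U.toContinuousLinearMap
  have hVU : ∀ x, V (U.toContinuousLinearMap x) = x := by
    intro x
    refine ext_inner_right ℂ fun w => ?_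
    rw [ContinuousLinearMap.adjoint_inner_left]
    exact U.inner_map_map x w
  have hU : ¬ Function.Surjective U.toContinuousLinearMap := by
    intro hs
    apply hEIc
    rw [eq_top_iff]
    intro y _
    rw [depOn_restIn_aux, depOn_comp_aux π (restIn I) hφ id measurable_id]
    obtain ⟨x, hx⟩ := hs y
    refine ⟨x, ?_, hx⟩
    have : AEStronglyMeasurable[MeasurableSpace.comap id inferInstance]
        (x : (∀ i : {i : Fin K // i ∈ I}, X i.val) → ℂ) (π.map (restIn I)) := by
      rw [MeasurableSpace.comap_id]
      exact Lp.aestronglyMeasurable x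
    exact this
  let P : Fin g → Lp ℂ 2 π →L[ℂ] Lp ℂ 2 π := fun d =>
    proj (depOn π (restOut (J d ∪ Iᶜ))) (isClosed_depOn π (measurable_restOut _))
  let Q : Fin g → Lp ℂ 2 (π.map (restIn I)) →L[ℂ] Lp ℂ 2 (π.map (restIn I)) := fun d =>
    proj (depOn (π.map (restIn I)) (restOutIn I (J d)))
      (isClosed_depOn _ (measurable_restOutIn I (J d)))
  have hPQ : ∀ d y, P d y = U.toContinuousLinearMap (Q d (V y)) := by
    intro d y
    refine proj_conj_aux U _ _ _ _ ?_ y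
    intro y
    rw [depOn_restOut_aux]
    exact depOn_comp_aux π (restIn I) hφ _ (measurable_restOutIn I (J d)) y
  have hC : ∀ y, proj (constSub π) (isClosed_constSub π) y = U.toContinuousLinearMap
      (proj (constSub (π.map (restIn I))) (isClosed_constSub _) (V y)) := by
    intro y
    exact proj_conj_aux U _ _ _ _ (constSub_aux π (restIn I) hφ) y
  let e : Lp ℂ 2 (π.map (restIn I)) := MemLp.toLp (fun _ => (1 : ℂ)) (memLp_const (1 : ℂ))
  have he : e ≠ 0 := by
    intro h
    have h1 : (fun _ => (1 : ℂ)) =ᵐ[π.map (restIn I)] (0 : (∀ i : {i : Fin K // i ∈ I}, X i.val) → ℂ) := by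
      refine (MemLp.coeFn_toLp (p := 2) (μ := π.map (restIn I)) (memLp_const (1 : ℂ))).symm.trans ?_
      have h2 : (e : (∀ i : {i : Fin K // i ∈ I}, X i.val) → ℂ) =ᵐ[π.map (restIn I)] 0 := by
        rw [h]; exact Lp.coeFn_zero _ _ _
      exact h2
    obtain ⟨x, hx⟩ := h1.exists
    exact one_ne_zero hx
  have hQe : ∀ d, Q d e = e := by
    intro d
    apply proj_fix_aux
    have : AEStronglyMeasurable[MeasurableSpace.comap (restOutIn I (J d)) inferInstance]
        (e : (∀ i : {i : Fin K // i ∈ I}, X i.val) → ℂ) (π.map (restIn I)) :=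
      ⟨fun _ => 1, stronglyMeasurable_const, MemLp.coeFn_toLp _⟩
    exact this
  have hCe : proj (constSub (π.map (restIn I))) (isClosed_constSub _) e = e :=
    proj_fix_aux _ _ _ (Submodule.mem_span_singleton_self _)
  refine ⟨?_, ?_⟩
  · refine spectrum_conj_aux U.toContinuousLinearMap V hVU hU _ _ ?_ e he ?_
    · intro y
      obtain ⟨n, rfl⟩ : ∃ n, g = n + 1 := ⟨g - 1, by omega⟩
      rw [ContinuousLinearMap.sub_apply, ContinuousLinearMap.sub_apply, map_sub, ← hC]
      congr 1
      exact list_prod_conj_aux _ _ hVU n Q P hPQ y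
    · rw [ContinuousLinearMap.sub_apply, hCe]
      exact sub_eq_zero.2 (list_prod_fix_aux e g Q hQe)
  · intro v _ hv
    refine spectrum_conj_aux U.toContinuousLinearMap V hVU hU _ _ ?_ e he ?_
    · intro y
      rw [ContinuousLinearMap.sub_apply, ContinuousLinearMap.sub_apply, map_sub, ← hC]
      congr 1
      rw [ContinuousLinearMap.sum_apply, ContinuousLinearMap.sum_apply, map_sum]
      refine Finset.sum_congr rfl fun d _ => ?_
      rw [ContinuousLinearMap.smul_apply, ContinuousLinearMap.smul_apply, map_smul]
      exact congrArg _ (hPQ d y)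
    · rw [ContinuousLinearMap.sub_apply, hCe, ContinuousLinearMap.sum_apply]
      refine sub_eq_zero.2 ?_
      calc _ = ∑ d, (v d : ℂ) • e := by
            refine Finset.sum_congr rfl fun d _ => ?_
            rw [ContinuousLinearMap.smul_apply]
            exact congrArg _ (hQe d)
        _ = e := by
            rw [← Finset.sum_smul, ← Complex.ofReal_sum, hv, Complex.ofReal_one, one_smul]
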